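/- arXiv:math/0612161 — 3 statements merged into one kernel-verified Lean document; each statement's English description precedes it below -/
import Mathlib

section
/- Let a ≥ 1, b ≥ 0 and let M = U^a ⊕ E8(−1)^b. Suppose v ∈ M ⊗ ℚ with v ∉ M, and let x be any real number. Then there exists a vector μ ∈ M such that |⟨μ − v, μ − v⟩ − x| < 1, where ⟨·,·⟩ is the ℚ-bilinear extension of the form on M. -/
open Matrix

/-- Gram matrix of the hyperbolic plane `U`. -/
def gramU : Matrix (Fin 2) (Fin 2) ℤ := !![0, 1; 1, 0]

/-- Gram matrix of `E8(−1)`, the negative of the E₈ Cartan (Gram) matrix. -/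
def gramE8neg : Matrix (Fin 8) (Fin 8) ℤ := - CartanMatrix.E₈

/-- Index type for the lattice `U^a ⊕ E8(−1)^b`. -/
abbrev IdxL (a b : ℕ) := (Fin 2 × Fin a) ⊕ (Fin 8 × Fin b)

/-- Gram matrix of `U^a ⊕ E8(−1)^b`. -/
def gramL (a b : ℕ) : Matrix (IdxL a b) (IdxL a b) ℤ :=
  Matrix.fromBlocks (Matrix.blockDiagonal fun _ => gramU) 0 0
    (Matrix.blockDiagonal fun _ => gramE8neg)

/-- The ℚ-bilinear extension of the form on `M = U^a ⊕ E8(−1)^b` to `M ⊗ ℚ`. -/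
def bilQ (a b : ℕ) (x y : IdxL a b → ℚ) : ℚ :=
  x ⬝ᵥ ((gramL a b).map (Int.cast : ℤ → ℚ)).mulVec y

theorem isSymm_gramL (a b : ℕ) : (gramL a b).IsSymm := by
  have hU : gramUᵀ = gramU := by decide
  have hE : gramE8negᵀ = gramE8neg := by decide
  unfold gramL Matrix.IsSymm
  rw [fromBlocks_transpose, blockDiagonal_transpose, blockDiagonal_transpose]
  simp [hU, hE]

theorem isUnit_det_gramL (a b : ℕ) : IsUnit (gramL a b).det := by
  have hU : IsUnit gramU.det := by simp [gramU]
  have hE : IsUnit gramE8neg.det := by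
    rw [gramE8neg, det_neg, CartanMatrix.E₈_det]
    simp
  rw [gramL, det_fromBlocks_zero₂₁, det_blockDiagonal, det_blockDiagonal]
  simp only [Finset.prod_const]
  exact (hU.pow _).mul (hE.pow _)

theorem even_gramL_diag (a b : ℕ) (k : IdxL a b) : Even (gramL a b k k) := by
  have hU : ∀ i, Even (gramU i i) := by decide
  have hE : ∀ i, Even (gramE8neg i i) := by decide
  rcases k with ⟨i, j⟩ | ⟨i, j⟩
  · simpa [gramL] using hU i
  · simpa [gramL] using hE i

theorem gramL_map_mulVec_inl_zero (a b : ℕ) (w : IdxL a b → ℚ) (j : Fin a) :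
    ((gramL a b).map (Int.cast : ℤ → ℚ)).mulVec w (Sum.inl (0, j)) = w (Sum.inl (1, j)) := by
  simp [gramL, mulVec, dotProduct, Fintype.sum_prod_type, blockDiagonal_apply, gramU]

theorem gramL_map_mulVec_inl_one (a b : ℕ) (w : IdxL a b → ℚ) (j : Fin a) :
    ((gramL a b).map (Int.cast : ℤ → ℚ)).mulVec w (Sum.inl (1, j)) = w (Sum.inl (0, j)) := by
  simp [gramL, mulVec, dotProduct, Fintype.sum_prod_type, blockDiagonal_apply, gramU]

/-- `U^a ⊕ E8(−1)^b` is its own dual lattice. -/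
theorem integral_of_gramL_map_mulVec_integral (a b : ℕ) (v : IdxL a b → ℚ)
    (h : ∀ k, ∃ n : ℤ, ((gramL a b).map (Int.cast : ℤ → ℚ)).mulVec v k = n) (i : IdxL a b) :
    ∃ n : ℤ, v i = n := by
  choose f hf using h
  have hinv : ((gramL a b)⁻¹.map (Int.cast : ℤ → ℚ)) * (gramL a b).map (Int.cast : ℤ → ℚ) = 1 := by
    have h1 : ((gramL a b)⁻¹ * gramL a b).map (Int.castRingHom ℚ) = 1 := by
      rw [nonsing_inv_mul _ (isUnit_det_gramL a b)]
      simp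
    rwa [Matrix.map_mul] at h1
  have hv : v = ((gramL a b)⁻¹.map (Int.cast : ℤ → ℚ)).mulVec (fun k => (f k : ℚ)) := by
    rw [← funext hf, mulVec_mulVec, hinv, one_mulVec]
  refine ⟨(gramL a b)⁻¹.mulVec f i, ?_⟩
  rw [hv]
  simp [mulVec, dotProduct]

theorem bilQ_add_single (a b : ℕ) (w : IdxL a b → ℚ) (k : IdxL a b) (c : ℚ) :
    bilQ a b (w + Pi.single k c) (w + Pi.single k c) =
      bilQ a b w w + 2 * c * ((gramL a b).map (Int.cast : ℤ → ℚ)).mulVec w k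
        + c ^ 2 * gramL a b k k := by
  have hs : ((gramL a b).map (Int.cast : ℤ → ℚ))ᵀ = (gramL a b).map (Int.cast : ℤ → ℚ) := by
    rw [← transpose_map, isSymm_gramL]
  have h : w ⬝ᵥ ((gramL a b).map (Int.cast : ℤ → ℚ)).mulVec (Pi.single k c) =
      c * ((gramL a b).map (Int.cast : ℤ → ℚ)).mulVec w k := by
    rw [dotProduct_mulVec, ← mulVec_transpose, hs, dotProduct_single, mul_comm]
  unfold bilQ
  rw [mulVec_add, dotProduct_add, add_dotProduct, add_dotProduct, h, single_dotProduct,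
    single_dotProduct]
  simp
  ring

/-- Translating along an isotropic basis vector changes the norm in steps of `2 * α`. -/
theorem exists_bilQ_add_single_near (a b : ℕ) (x : ℝ) (w : IdxL a b → ℚ) (k : IdxL a b)
    (hk : gramL a b k k = 0) {α : ℚ} (hα : α ≠ 0)
    (hw : ((gramL a b).map (Int.cast : ℤ → ℚ)).mulVec w k = α) :
    ∃ n : ℤ, bilQ a b (w + Pi.single k (n : ℚ)) (w + Pi.single k (n : ℚ)) =
        bilQ a b w w + 2 * n * α ∧
      |((bilQ a b (w + Pi.single k (n : ℚ)) (w + Pi.single k (n : ℚ)) : ℚ) : ℝ) - x| ≤ |(α : ℝ)| := by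
  have hα' : (α : ℝ) ≠ 0 := by exact_mod_cast hα
  set y : ℝ := (x - (bilQ a b w w : ℚ)) / (2 * α) with hy
  have hq : bilQ a b (w + Pi.single k ((round y : ℤ) : ℚ)) (w + Pi.single k ((round y : ℤ) : ℚ)) =
      bilQ a b w w + 2 * (round y : ℤ) * α := by
    rw [bilQ_add_single, hk, hw]; simp
  refine ⟨round y, hq, ?_⟩
  rw [hq]
  have hxy : x = (bilQ a b w w : ℚ) + 2 * y * α := by
    rw [hy]; field_simp; ring
  have habs := abs_sub_round y
  have heq : (((bilQ a b w w + 2 * (round y : ℤ) * α : ℚ)) : ℝ) - x = -(2 * α * (y - round y)) := by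
    rw [hxy]; push_cast; ring
  rw [heq, abs_neg, abs_mul, abs_mul, abs_two]
  nlinarith [abs_nonneg (α : ℝ)]

/-- The case of a vector with a non-integral coordinate dual to an isotropic basis vector. -/
theorem exists_near_of_not_integral (a b : ℕ) (x : ℝ) (v : IdxL a b → ℚ) (i k : IdxL a b)
    (hk : gramL a b k k = 0)
    (hik : ∀ w, ((gramL a b).map (Int.cast : ℤ → ℚ)).mulVec w k = w i)
    (hv : ¬ ∃ n : ℤ, v i = n) :
    ∃ μ : IdxL a b → ℤ,
      |((bilQ a b ((fun i => (μ i : ℚ)) - v) ((fun i => (μ i : ℚ)) - v) : ℚ) : ℝ) - x| < 1 := by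
  set ν : IdxL a b → ℤ := fun j => round (v j)
  have hα : (round (v i) : ℚ) - v i ≠ 0 := fun h => hv ⟨round (v i), by linarith⟩
  obtain ⟨n, -, hn⟩ := exists_bilQ_add_single_near a b x ((fun j => (ν j : ℚ)) - v) k hk hα
    (by rw [hik]; rfl)
  refine ⟨ν + Pi.single k n, ?_⟩
  have hμ : (fun j => (((ν + Pi.single k n : IdxL a b → ℤ) j : ℤ) : ℚ)) - v =
      (fun j => (ν j : ℚ)) - v + Pi.single k (n : ℚ) := by
    ext j
    by_cases h : j = k
    · subst h; simp; ring
    · simp [h]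
  rw [hμ]
  refine hn.trans_lt ?_
  have h := abs_sub_round (v i)
  rw [abs_sub_comm] at h
  have h' : |((round (v i) : ℚ) - v i : ℚ)| < 1 := h.trans_lt (by norm_num)
  exact_mod_cast h'

/-- if `v ∈ M ⊗ ℚ` with `v ∉ M` (`M = U^a ⊕ E8(−1)^b`, `a ≥ 1`), then for
any real `x` there is `μ ∈ M` with `|⟨μ − v, μ − v⟩ − x| < 1`. -/
theorem statement8 (a b : ℕ) (ha : 1 ≤ a) (x : ℝ)
    (v : IdxL a b → ℚ) (hv : ¬ ∀ i, ∃ n : ℤ, v i = (n : ℚ)) :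
    ∃ μ : IdxL a b → ℤ,
      |((bilQ a b ((fun i => (μ i : ℚ)) - v) ((fun i => (μ i : ℚ)) - v) : ℚ) : ℝ) - x|
        < 1 := by
  have a0 : Fin a := ⟨0, ha⟩
  have hd0 : gramL a b (Sum.inl (0, a0)) (Sum.inl (0, a0)) = 0 := by simp [gramL, gramU]
  have hd1 : gramL a b (Sum.inl (1, a0)) (Sum.inl (1, a0)) = 0 := by simp [gramL, gramU]
  by_cases h0 : ∃ n : ℤ, v (Sum.inl (0, a0)) = n
  swap
  · exact exists_near_of_not_integral a b x v _ _ hd1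
      (fun w => gramL_map_mulVec_inl_one a b w a0) h0
  by_cases h1 : ∃ n : ℤ, v (Sum.inl (1, a0)) = n
  swap
  · exact exists_near_of_not_integral a b x v _ _ hd0
      (fun w => gramL_map_mulVec_inl_zero a b w a0) h1
  obtain ⟨k, hk⟩ : ∃ k, ¬ ∃ n : ℤ, ((gramL a b).map (Int.cast : ℤ → ℚ)).mulVec v k = n := by
    by_contra! h
    exact hv (integral_of_gramL_map_mulVec_integral a b v h)
  have hk0 : Sum.inl (0, a0) ≠ k := by
    rintro rfl
    exact hk (by rwa [gramL_map_mulVec_inl_zero])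
  obtain ⟨m, hm⟩ := h0
  set ν : IdxL a b → ℤ := Pi.single (Sum.inl (0, a0)) (m + 1)
  set w : IdxL a b → ℚ := (fun j => (ν j : ℚ)) - v with hw
  have hw0 : w (Sum.inl (0, a0)) = 1 := by simp [hw, ν, hm]
  set e : IdxL a b := Sum.inl (1, a0)
  have hwe : ((gramL a b).map (Int.cast : ℤ → ℚ)).mulVec w e = 1 := by
    rw [gramL_map_mulVec_inl_one, hw0]
  have hwe' : ((gramL a b).map (Int.cast : ℤ → ℚ)).mulVec (w + Pi.single k 1) e = 1 := by
    rw [gramL_map_mulVec_inl_one, Pi.add_apply, hw0, Pi.single_eq_of_ne hk0, add_zero]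
  obtain ⟨n, hn, hn'⟩ := exists_bilQ_add_single_near a b x w e hd1 one_ne_zero hwe
  obtain ⟨l, hl, hl'⟩ := exists_bilQ_add_single_near a b x _ e hd1 one_ne_zero hwe'
  have hμn : (fun j => (((ν + Pi.single e n : IdxL a b → ℤ) j : ℤ) : ℚ)) - v = w + Pi.single e (n : ℚ) := by
    ext j
    simp [hw, Pi.single_apply, apply_ite (Int.cast : ℤ → ℚ)]
    ring
  have hμl :
      (fun j => (((ν + Pi.single k 1 + Pi.single e l : IdxL a b → ℤ) j : ℤ) : ℚ)) - v =
      w + Pi.single k 1 + Pi.single e (l : ℚ) := by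
    ext j
    simp [hw, Pi.single_apply, apply_ite (Int.cast : ℤ → ℚ)]
    ring
  by_contra! hcon
  have hcn := hcon (ν + Pi.single e n)
  have hcl := hcon (ν + Pi.single k 1 + Pi.single e l)
  rw [hμn] at hcn
  rw [hμl] at hcl
  rw [Rat.cast_one, abs_one] at hn' hl'
  obtain ⟨r, hr⟩ := even_gramL_diag a b k
  have hstep := bilQ_add_single a b w k 1
  have hwk : ((gramL a b).map (Int.cast : ℤ → ℚ)).mulVec w k =
      ((gramL a b).mulVec ν k : ℤ) - ((gramL a b).map (Int.cast : ℤ → ℚ)).mulVec v k := by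
    rw [hw, mulVec_sub, Pi.sub_apply]
    simp [mulVec, dotProduct]
  set c := ((gramL a b).map (Int.cast : ℤ → ℚ)).mulVec v k
  set z := (gramL a b).mulVec ν k
  rw [hwk, hr] at hstep
  -- Both norms lie at distance exactly one from `x`, so they agree modulo two.
  have key : ∃ s : ℤ, bilQ a b (w + Pi.single k 1 + Pi.single e (l : ℚ))
      (w + Pi.single k 1 + Pi.single e (l : ℚ)) -
      bilQ a b (w + Pi.single e (n : ℚ)) (w + Pi.single e (n : ℚ)) = 2 * s := by
    rcases (abs_eq zero_le_one).1 (le_antisymm hn' hcn) with hA | hA <;>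
      rcases (abs_eq zero_le_one).1 (le_antisymm hl' hcl) with hB | hB
    · exact ⟨0, by rify; linarith⟩
    · exact ⟨-1, by rify; linarith⟩
    · exact ⟨1, by rify; linarith⟩
    · exact ⟨0, by rify; linarith⟩
  obtain ⟨s, hs⟩ := key
  refine hk ⟨z + r + l - n - s, ?_⟩
  push_cast at hstep ⊢
  linarith
end

section
/- Let a ≥ 1, b ≥ 0, set L = U^a ⊕ E8(−1)^b and M = L ⊕ U, where the last summand U has basis f_1, f_2 with ⟨f_1,f_1⟩ = ⟨f_2,f_2⟩ = 0 and ⟨f_1,f_2⟩ = 1. Let δ = v + k f_2 with v ∈ L and k ∈ ℤ (so the f_1-coefficient of δ is 0), and suppose ⟨δ,δ⟩ = −2. Then there exists an isometry g ∈ O(M) such that g(δ) ∈ L (i.e. g(δ) has both U-coordinates zero). -/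
open Matrix

/-- Index type for `M = L ⊕ U`; the last `U` summand has basis `f₁ = inr 0`, `f₂ = inr 1`. -/
abbrev IdxM (a b : ℕ) := IdxL a b ⊕ Fin 2

/-- Gram matrix of `M = L ⊕ U`. -/
def gramM (a b : ℕ) : Matrix (IdxM a b) (IdxM a b) ℤ :=
  Matrix.fromBlocks (gramL a b) 0 0 gramU

/-- The bilinear form on `M = L ⊕ U`. Elements `(v,m,n) = v + m f₁ + n f₂` of `M` are
functions `IdxM a b → ℤ`, with `m = ·(Sum.inr 0)`, `n = ·(Sum.inr 1)`. -/
def bilM (a b : ℕ) (x y : IdxM a b → ℤ) : ℤ := x ⬝ᵥ (gramM a b).mulVec y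


section Eichler

variable {ι : Type*} [Fintype ι]

/-- A symmetric integral matrix of the shape `B + Bᵀ` takes even values on the diagonal. -/
theorem dotProduct_add_transpose_mulVec_self (B : Matrix ι ι ℤ) (x : ι → ℤ) :
    x ⬝ᵥ (B + Bᵀ) *ᵥ x = 2 * (x ⬝ᵥ B *ᵥ x) := by
  rw [Matrix.add_mulVec, dotProduct_add, Matrix.mulVec_transpose, dotProduct_comm x (x ᵥ* B),
    ← Matrix.dotProduct_mulVec]
  ring

theorem dotProduct_add_transpose_mulVec_comm (B : Matrix ι ι ℤ) (x y : ι → ℤ) :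
    x ⬝ᵥ (B + Bᵀ) *ᵥ y = y ⬝ᵥ (B + Bᵀ) *ᵥ x := by
  rw [Matrix.dotProduct_mulVec, ← Matrix.mulVec_transpose, dotProduct_comm]
  simp [add_comm]

/-- In an even unimodular lattice, a vector of square `-2` pairs to every integer. -/
theorem exists_dotProduct_mulVec_eq [DecidableEq ι] {B C : Matrix ι ι ℤ}
    (hC : C * (B + Bᵀ) = 1) {v : ι → ℤ} (hv : v ⬝ᵥ (B + Bᵀ) *ᵥ v = -2) (k : ℤ) :
    ∃ w : ι → ℤ, w ⬝ᵥ (B + Bᵀ) *ᵥ v = k := by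
  set u := (B + Bᵀ) *ᵥ v with hu
  obtain ⟨d, hd⟩ := (IsPrincipalIdealRing.principal (Ideal.span (Set.range u))).principal
  have hdvd : ∀ i, d ∣ u i := fun i => by
    have h : u i ∈ Ideal.span (Set.range u) := Ideal.subset_span ⟨i, rfl⟩
    rw [hd] at h
    exact Ideal.mem_span_singleton.1 h
  choose c hc using hdvd
  have huc : u = d • c := funext hc
  have hvc : v = d • (C *ᵥ c) := by
    rw [← Matrix.mulVec_smul, ← huc, hu, Matrix.mulVec_mulVec, hC, Matrix.one_mulVec]
  have hsq : d * d * ((C *ᵥ c) ⬝ᵥ B *ᵥ (C *ᵥ c)) = -1 := by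
    have h : v ⬝ᵥ (B + Bᵀ) *ᵥ v = -2 := hv
    rw [dotProduct_add_transpose_mulVec_self, hvc, Matrix.mulVec_smul, smul_dotProduct,
      dotProduct_smul, smul_eq_mul, smul_eq_mul] at h
    linarith
  have hunit : IsUnit d := by
    refine IsUnit.of_mul_eq_one (-(d * ((C *ᵥ c) ⬝ᵥ B *ᵥ (C *ᵥ c)))) ?_
    linarith
  have hk : k ∈ Ideal.span (Set.range u) := by
    rw [hd]
    exact Ideal.mem_span_singleton.2 (hunit.dvd)
  obtain ⟨w, hw⟩ := (Ideal.mem_span_range_iff_exists_fun).1 hk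
  exact ⟨w, hw⟩

/-- The Eichler transvection along `f₂` and `w` on the lattice with Gram matrix
`(B + Bᵀ) ⊕ U`. -/
def eichler (B : Matrix ι ι ℤ) (w : ι → ℤ) : (ι ⊕ Fin 2 → ℤ) →ₗ[ℤ] (ι ⊕ Fin 2 → ℤ) where
  toFun x := Sum.elim (x ∘ Sum.inl + x (Sum.inr 0) • w)
    ![x (Sum.inr 0),
      x (Sum.inr 1) - w ⬝ᵥ (B + Bᵀ) *ᵥ (x ∘ Sum.inl) - x (Sum.inr 0) * (w ⬝ᵥ B *ᵥ w)]
  map_add' x y := by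
    have h : (x + y) ∘ Sum.inl = x ∘ (Sum.inl : ι → ι ⊕ Fin 2) + y ∘ Sum.inl := rfl
    ext (i | i)
    · simp; ring
    · fin_cases i
      · simp
      · simp only [h, Matrix.mulVec_add, dotProduct_add]
        simp; ring
  map_smul' r x := by
    have h : (r • x) ∘ Sum.inl = r • (x ∘ (Sum.inl : ι → ι ⊕ Fin 2)) := rfl
    ext (i | i)
    · simp; ring
    · fin_cases i
      · simp
      · simp only [h, Matrix.mulVec_smul, dotProduct_smul]
        simp; ring

@[simp] theorem eichler_comp_inl (B : Matrix ι ι ℤ) (w : ι → ℤ) (x : ι ⊕ Fin 2 → ℤ) :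
    eichler B w x ∘ Sum.inl = x ∘ Sum.inl + x (Sum.inr 0) • w := rfl

@[simp] theorem eichler_inr_zero (B : Matrix ι ι ℤ) (w : ι → ℤ) (x : ι ⊕ Fin 2 → ℤ) :
    eichler B w x (Sum.inr 0) = x (Sum.inr 0) := rfl

@[simp] theorem eichler_inr_one (B : Matrix ι ι ℤ) (w : ι → ℤ) (x : ι ⊕ Fin 2 → ℤ) :
    eichler B w x (Sum.inr 1) = x (Sum.inr 1) - w ⬝ᵥ (B + Bᵀ) *ᵥ (x ∘ Sum.inl)
      - x (Sum.inr 0) * (w ⬝ᵥ B *ᵥ w) := rfl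

theorem eichler_neg_eichler (B : Matrix ι ι ℤ) (w : ι → ℤ) (x : ι ⊕ Fin 2 → ℤ) :
    eichler B (-w) (eichler B w x) = x := by
  have hl : eichler B (-w) (eichler B w x) ∘ Sum.inl = x ∘ Sum.inl := by simp
  ext (i | i)
  · exact congrFun hl i
  · fin_cases i
    · simp
    · simp only [Fin.mk_one, eichler_inr_one, eichler_inr_zero, eichler_comp_inl,
        Matrix.mulVec_add, Matrix.mulVec_smul, dotProduct_add, dotProduct_smul, neg_dotProduct,
        dotProduct_add_transpose_mulVec_self, Matrix.mulVec_neg, dotProduct_neg, smul_eq_mul]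
      ring

/-- The Eichler transvection as a linear automorphism. -/
def eichlerEquiv (B : Matrix ι ι ℤ) (w : ι → ℤ) : (ι ⊕ Fin 2 → ℤ) ≃ₗ[ℤ] (ι ⊕ Fin 2 → ℤ) :=
  LinearEquiv.ofLinearMap (eichler B w) (eichler B (-w))
    (LinearMap.ext fun x => by simpa using eichler_neg_eichler B (-w) x)
    (LinearMap.ext fun x => eichler_neg_eichler B w x)

theorem dotProduct_fromBlocks_gramU_mulVec (G : Matrix ι ι ℤ) (x y : ι ⊕ Fin 2 → ℤ) :
    x ⬝ᵥ (Matrix.fromBlocks G 0 0 gramU) *ᵥ y =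
      (x ∘ Sum.inl) ⬝ᵥ G *ᵥ (y ∘ Sum.inl) +
        (x (Sum.inr 0) * y (Sum.inr 1) + x (Sum.inr 1) * y (Sum.inr 0)) := by
  rw [Matrix.fromBlocks_mulVec]
  simp [dotProduct, Fintype.sum_sum_type, gramU, Matrix.mulVec, Fin.sum_univ_two]

theorem eichler_isometry (B : Matrix ι ι ℤ) (w : ι → ℤ) (x y : ι ⊕ Fin 2 → ℤ) :
    eichler B w x ⬝ᵥ (Matrix.fromBlocks (B + Bᵀ) 0 0 gramU) *ᵥ eichler B w y =
      x ⬝ᵥ (Matrix.fromBlocks (B + Bᵀ) 0 0 gramU) *ᵥ y := by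
  simp only [dotProduct_fromBlocks_gramU_mulVec, eichler_inr_one, eichler_inr_zero,
    eichler_comp_inl, Matrix.mulVec_add, Matrix.mulVec_smul, dotProduct_add, dotProduct_smul,
    add_dotProduct, smul_dotProduct, dotProduct_add_transpose_mulVec_self, smul_eq_mul,
    dotProduct_add_transpose_mulVec_comm B (x ∘ Sum.inl) w]
  ring

end Eichler

/-- The upper triangular half of the Gram matrix of `E8(−1)`. -/
def halfE8neg : Matrix (Fin 8) (Fin 8) ℤ :=
  Matrix.of fun i j => if i < j then gramE8neg i j else if i = j then -1 else 0

/-- The upper triangular half of the Gram matrix of `L`. -/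
def halfL (a b : ℕ) : Matrix (IdxL a b) (IdxL a b) ℤ :=
  Matrix.fromBlocks (Matrix.blockDiagonal fun _ => !![0, 1; 0, 0]) 0 0
    (Matrix.blockDiagonal fun _ => halfE8neg)

theorem gramE8neg_eq_add_transpose : gramE8neg = halfE8neg + halfE8negᵀ := by
  decide

theorem gramU_eq_add_transpose : gramU = !![0, 1; 0, 0] + !![0, 1; 0, 0]ᵀ := by
  decide

theorem gramL_eq_add_transpose (a b : ℕ) : gramL a b = halfL a b + (halfL a b)ᵀ := by
  rw [gramL, halfL, Matrix.fromBlocks_transpose, Matrix.fromBlocks_add,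
    Matrix.blockDiagonal_transpose, Matrix.blockDiagonal_transpose, ← Matrix.blockDiagonal_add,
    ← Matrix.blockDiagonal_add, gramU_eq_add_transpose, gramE8neg_eq_add_transpose]
  simp [Pi.add_def]

/-- The inverse of the Gram matrix of `E8(−1)`. -/
def invE8neg : Matrix (Fin 8) (Fin 8) ℤ :=
  !![-4, -5, -7, -10, -8, -6, -4, -2;
     -5, -8, -10, -15, -12, -9, -6, -3;
     -7, -10, -14, -20, -16, -12, -8, -4;
     -10, -15, -20, -30, -24, -18, -12, -6;
     -8, -12, -16, -24, -20, -15, -10, -5;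
     -6, -9, -12, -18, -15, -12, -8, -4;
     -4, -6, -8, -12, -10, -8, -6, -3;
     -2, -3, -4, -6, -5, -4, -3, -2]

theorem invE8neg_mul_gramE8neg : invE8neg * gramE8neg = 1 := by
  decide

theorem gramU_mul_gramU : gramU * gramU = 1 := by
  decide

theorem exists_mul_gramL_eq_one (a b : ℕ) :
    ∃ C : Matrix (IdxL a b) (IdxL a b) ℤ, C * gramL a b = 1 := by
  refine ⟨Matrix.fromBlocks (Matrix.blockDiagonal fun _ => gramU) 0 0
    (Matrix.blockDiagonal fun _ => invE8neg), ?_⟩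
  rw [gramL, Matrix.fromBlocks_multiply, ← Matrix.blockDiagonal_mul, ← Matrix.blockDiagonal_mul,
    gramU_mul_gramU, invE8neg_mul_gramE8neg, ← Pi.one_def, ← Pi.one_def]
  simp

/-- if `δ = v + k f₂` (`v ∈ L`, i.e. the `f₁`-coefficient of `δ` is `0`)
and `⟨δ,δ⟩ = −2`, then there is an isometry `g ∈ O(M)` with `g(δ) ∈ L` (both
`U`-coordinates of `g(δ)` vanish). -/
theorem statement11 (a b : ℕ) (ha : 1 ≤ a) (δ : IdxM a b → ℤ)
    (hδ2 : bilM a b δ δ = -2) (hδ1 : δ (Sum.inr 0) = 0) :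
    ∃ g : (IdxM a b → ℤ) ≃ₗ[ℤ] (IdxM a b → ℤ),
      (∀ x y, bilM a b (g x) (g y) = bilM a b x y) ∧
      ∀ i : Fin 2, g δ (Sum.inr i) = 0 := by
  obtain ⟨C, hC⟩ := exists_mul_gramL_eq_one a b
  simp only [bilM, gramM] at hδ2 ⊢
  rw [gramL_eq_add_transpose] at hC hδ2 ⊢
  have hv : (δ ∘ Sum.inl) ⬝ᵥ (halfL a b + (halfL a b)ᵀ) *ᵥ (δ ∘ Sum.inl) = -2 := by
    rw [dotProduct_fromBlocks_gramU_mulVec, hδ1] at hδ2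
    linarith
  obtain ⟨w, hw⟩ := exists_dotProduct_mulVec_eq hC hv (δ (Sum.inr 1))
  refine ⟨eichlerEquiv (halfL a b) w, eichler_isometry (halfL a b) w, fun i => ?_⟩
  change eichler (halfL a b) w δ (Sum.inr i) = 0
  fin_cases i
  · simpa using hδ1
  · simp [hw, hδ1]
end

section
/- Let L be any even lattice and M = U ⊕ L, where U has basis f_1, f_2 with ⟨f_1,f_1⟩ = ⟨f_2,f_2⟩ = 0 and ⟨f_1,f_2⟩ = 1. Then the primitive isotropic vectors of M generate M as a ℤ-module; that is, every element of M is a ℤ-linear combination of vectors ρ ∈ M with ⟨ρ,ρ⟩ = 0 and ρ primitive (ρ is not of the form mw with w ∈ M and m ∈ ℤ, |m| ≥ 2). -/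
/-- A vector of `(Fin 2 → ℤ) × L` with a hyperbolic coordinate equal to `1` is primitive. -/
theorem not_exists_eq_smul_of_coord_eq_one {L : Type*} [AddCommGroup L] [Module ℤ L]
    {ρ : (Fin 2 → ℤ) × L} {i : Fin 2} (h : ρ.1 i = 1) :
    ¬ ∃ (w : (Fin 2 → ℤ) × L) (m : ℤ), 2 ≤ |m| ∧ ρ = m • w := by
  rintro ⟨w, m, hm, rfl⟩
  have hu : IsUnit m := IsUnit.of_mul_eq_one (w.1 i) (by simpa using h)
  rw [Int.isUnit_iff_abs_eq] at hu
  omega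

/-- for any even lattice `L` and `M = U ⊕ L` (the `U` summand has basis
`f₁, f₂` with `⟨fᵢ,fᵢ⟩ = 0`, `⟨f₁,f₂⟩ = 1`, so `M = (Fin 2 → ℤ) × L` with form
`B((u,x),(v,y)) = u 0 * v 1 + u 1 * v 0 + BL x y`), the primitive isotropic vectors of
`M` span `M` over ℤ. -/
theorem statement14 (L : Type*) [AddCommGroup L] [Module ℤ L]
    [Module.Free ℤ L] [Module.Finite ℤ L]
    (BL : LinearMap.BilinForm ℤ L) (hsymm : ∀ x y, BL x y = BL y x)
    (heven : ∀ x, Even (BL x x)) :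
    Submodule.span ℤ {ρ : (Fin 2 → ℤ) × L |
        (ρ.1 0 * ρ.1 1 + ρ.1 1 * ρ.1 0 + BL ρ.2 ρ.2 = 0) ∧
        ¬ ∃ (w : (Fin 2 → ℤ) × L) (m : ℤ), 2 ≤ |m| ∧ ρ = m • w} = ⊤ := by
  refine eq_top_iff.2 fun p _ => ?_
  obtain ⟨u, x⟩ := p
  obtain ⟨k, hk⟩ := heven x
  have key : (u, x) = (u 0 - 1) • ((![1, 0], 0) : (Fin 2 → ℤ) × L) +
      (u 1 + k) • ((![0, 1], 0) : (Fin 2 → ℤ) × L) + (![1, -k], x) := by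
    refine Prod.ext ?_ (by simp [zsmul_zero])
    ext i
    fin_cases i <;> simp
  rw [key]
  refine add_mem (add_mem (Submodule.smul_mem _ _ (Submodule.subset_span ?_))
    (Submodule.smul_mem _ _ (Submodule.subset_span ?_))) (Submodule.subset_span ?_)
  · exact ⟨by simp, not_exists_eq_smul_of_coord_eq_one (i := 0) rfl⟩
  · exact ⟨by simp, not_exists_eq_smul_of_coord_eq_one (i := 1) rfl⟩
  · exact ⟨by simp [hk], not_exists_eq_smul_of_coord_eq_one (i := 0) rfl⟩
end
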